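/- Let ℙ be a finitely characterized, stationary, ergodic process over a finite alphabet 𝒳 with positive-probability predictive equivalence classes E_1,…,E_N, history ε-machine matrices {T^(x)}, and μ = (ℙ^-(E_1),…,ℙ^-(E_N)). Then for every word w ∈ 𝒳*, ℙ(w) = ‖μ T^(w)‖₁, where T^(w) = T^(w_0)⋯T^(w_{l-1}) for w = w_0…w_{l-1}. -/

import Mathlib

open MeasureTheory Filter Topology
open scoped Classical

namespace EM

variable {X : Type*} [Fintype X] [MeasurableSpace X] [MeasurableSingletonClass X]

/-- The left shift on bi-infinite sequences. -/
def shift (ω : ℤ → X) : ℤ → X := fun n => ω (n + 1)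

/-- ℙ(w): probability of the cylinder set of the word `w` at position 0. -/
noncomputable def wordProb (μ : Measure (ℤ → X)) (w : List X) : ℝ :=
  (μ {ω | ∀ k : Fin w.length, ω ((k : ℕ) : ℤ) = w.get k}).toReal

/-- Stationarity: invariance of the measure under the shift. -/
def Stationary (μ : Measure (ℤ → X)) : Prop := Measure.map shift μ = μ

/-- Ergodicity: every shift-invariant measurable event is trivial. -/
def Ergodic' (μ : Measure (ℤ → X)) : Prop :=
  ∀ A : Set (ℤ → X), MeasurableSet A → shift ⁻¹' A = A → μ A = 0 ∨ μ A = 1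

/-- Projection of a bi-infinite sequence to its past:  (pastMap ω) n = x_{-(n+1)}. -/
def pastMap (ω : ℤ → X) : ℕ → X := fun n => ω (-((n : ℤ) + 1))

/-- ℙ⁻ : the marginal of ℙ on past sequences. -/
noncomputable def pastMeasure (μ : Measure (ℤ → X)) : Measure (ℕ → X) :=
  Measure.map pastMap μ

/-- x⃖^t = x_{-t} … x_{-1}, the last `t` symbols of the past `p`, as a word. -/
def pastWord (p : ℕ → X) (t : ℕ) : List X := (List.range t).reverse.map p

/-- A past is nontrivial if all of its finite suffixes have positive probability. -/
def Nontrivial' (μ : Measure (ℤ → X)) (p : ℕ → X) : Prop :=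
  ∀ t : ℕ, 0 < wordProb μ (pastWord p t)

/-- ℙ(w | v) = ℙ(vw)/ℙ(v): conditional probability that `w` follows `v`. -/
noncomputable def condProb (μ : Measure (ℤ → X)) (w v : List X) : ℝ :=
  wordProb μ (v ++ w) / wordProb μ v

/-- A past is `w`-regular if it is nontrivial and lim_{t→∞} ℙ(w|x⃖^t) exists. -/
def WRegular (μ : Measure (ℤ → X)) (p : ℕ → X) (w : List X) : Prop :=
  Nontrivial' μ p ∧ ∃ L : ℝ, Tendsto (fun t => condProb μ w (pastWord p t)) atTop (𝓝 L)

/-- A past is regular if it is nontrivial and `w`-regular for every nonempty word `w`. -/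
def Regular (μ : Measure (ℤ → X)) (p : ℕ → X) : Prop :=
  Nontrivial' μ p ∧ ∀ w : List X, w ≠ [] →
    ∃ L : ℝ, Tendsto (fun t => condProb μ w (pastWord p t)) atTop (𝓝 L)

/-- 𝐏(w|x⃖) = lim_{t→∞} ℙ(w|x⃖^t)  (meaningful for regular pasts). -/
noncomputable def predProb (μ : Measure (ℤ → X)) (p : ℕ → X) (w : List X) : ℝ :=
  limUnder atTop (fun t => condProb μ w (pastWord p t))

/-- The past x⃖x obtained by appending the symbol `x` to the past x⃖. -/
def extendPast (p : ℕ → X) (x : X) : ℕ → X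
  | 0 => x
  | n + 1 => p n

/-- The past obtained by appending a word symbol by symbol. -/
def extendWord (p : ℕ → X) : List X → (ℕ → X)
  | [] => p
  | x :: u => extendWord (extendPast p x) u

/-- The predictive equivalence class of the (regular) past `p`. -/
def classOf (μ : Measure (ℤ → X)) (p : ℕ → X) : Set (ℕ → X) :=
  {q | Regular μ q ∧ ∀ w : List X, w ≠ [] → predProb μ q w = predProb μ p w}

section HMM

variable {S : Type*} [Fintype S] [DecidableEq S]

/-- T^(w) = T^(w₀) ⋯ T^(w_{l-1}). -/
def wordMatrix (T : X → Matrix S S ℝ) (w : List X) : Matrix S S ℝ :=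
  (w.map T).prod

/-- 𝐏_{σ_i}(w) = ‖e_i T^(w)‖₁, the probability of emitting `w` from state `i`. -/
noncomputable def stateWordProb (T : X → Matrix S S ℝ) (i : S) (w : List X) : ℝ :=
  ∑ j, wordMatrix T w i j

/-- All transition matrices have nonnegative entries. -/
def HMMNonneg (T : X → Matrix S S ℝ) : Prop := ∀ x i j, 0 ≤ T x i j

/-- The overall transition matrix T = Σ_x T^(x) is row-stochastic. -/
def HMMStochastic (T : X → Matrix S S ℝ) : Prop := ∀ i, ∑ x : X, ∑ j, T x i j = 1

/-- The overall state-to-state transition matrix T = Σ_x T^(x). -/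
noncomputable def totalT (T : X → Matrix S S ℝ) : Matrix S S ℝ := ∑ x : X, T x

/-- Irreducibility: the directed graph with an edge i → j whenever T_{ij} > 0 is
strongly connected. -/
def Irreducible' (T : X → Matrix S S ℝ) : Prop :=
  ∀ i j : S, ∃ n : ℕ, 0 < n ∧ 0 < (totalT T ^ n) i j

/-- Unifilarity: from each state, each symbol leads to at most one state. -/
def Unifilar (T : X → Matrix S S ℝ) : Prop :=
  ∀ (x : X) (i j k : S), 0 < T x i j → 0 < T x i k → j = k

/-- Probabilistically distinct states. -/
def ProbDistinct (T : X → Matrix S S ℝ) : Prop :=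
  ∀ i j : S, i ≠ j → ∃ w : List X, w ≠ [] ∧ stateWordProb T i w ≠ stateWordProb T j w

/-- π is a stationary distribution for the HMM: π ≥ 0, Σπ = 1, π = πT. -/
def IsStationaryDist (T : X → Matrix S S ℝ) (π : S → ℝ) : Prop :=
  (∀ i, 0 ≤ π i) ∧ (∑ i, π i = 1) ∧ (∀ j, ∑ i, π i * totalT T i j = π j)

/-- A generator ε-machine: a valid, irreducible, unifilar HMM with
probabilistically distinct states. -/
def IsGenEM (T : X → Matrix S S ℝ) : Prop :=
  HMMNonneg T ∧ HMMStochastic T ∧ Irreducible' T ∧ Unifilar T ∧ ProbDistinct T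

/-- The set of regular pasts whose predictions agree with state `i` of the HMM `T`. -/
def stateClass (μ : Measure (ℤ → X)) (T : X → Matrix S S ℝ) (i : S) : Set (ℕ → X) :=
  {q | Regular μ q ∧ ∀ w : List X, w ≠ [] → predProb μ q w = stateWordProb T i w}

end HMM

/-- The symbol-labeled transition matrices of the history ε-machine, given
representatives `p i` of the positive-probability predictive equivalence classes:
T^(x)_{ij} = 𝐏(x|E_i) if 𝐏(x|E_i) > 0 and δ_h(E_i,x) = E_j, and 0 otherwise. -/
noncomputable def histT (μ : Measure (ℤ → X)) {N : ℕ} (p : Fin N → (ℕ → X)) (x : X) :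
    Matrix (Fin N) (Fin N) ℝ := fun i j =>
  if 0 < predProb μ (p i) [x] ∧ classOf μ (extendPast (p i) x) = classOf μ (p j)
  then predProb μ (p i) [x] else 0

/-- ℙ is finitely characterized, with the pasts `p i` representing the finitely many
positive-probability predictive equivalence classes E_i = classOf μ (p i). -/
def FinitelyCharacterized (μ : Measure (ℤ → X)) {N : ℕ} (p : Fin N → (ℕ → X)) : Prop :=
  (∀ i, Regular μ (p i)) ∧
  (∀ i j : Fin N, i ≠ j → classOf μ (p i) ≠ classOf μ (p j)) ∧
  (∀ i, 0 < pastMeasure μ (classOf μ (p i))) ∧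
  (∑ i, pastMeasure μ (classOf μ (p i)) = 1)

end EM

namespace EM

section WordCylinders

variable {X : Type*}

/-- The word `ω 0 … ω (n - 1)`. -/
def initialWord (n : ℕ) (ω : ℤ → X) : List X := (List.range n).map fun k : ℕ => ω k

/-- The set of sequences containing the word `w` at position `0`. -/
def wordCylinder (w : List X) : Set (ℤ → X) := {ω | initialWord w.length ω = w}

theorem wordProb_eq_measureReal [Fintype X] [MeasurableSpace X] (μ : Measure (ℤ → X))
    (w : List X) : wordProb μ w = μ.real (wordCylinder w) := by
  have h : {ω : ℤ → X | ∀ k : Fin w.length, ω ((k : ℕ) : ℤ) = w.get k} = wordCylinder w := by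
    ext ω
    simp only [wordCylinder, initialWord, Set.mem_ofPred_eq]
    constructor
    · intro h
      refine List.ext_getElem (by simp) fun i h1 h2 => ?_
      simpa using h ⟨i, h2⟩
    · intro h k
      have := List.getElem_of_eq h (i := k) (by simp)
      simpa using this
  rw [wordProb, h, Measure.real]

theorem pastWord_succ (p : ℕ → X) (t : ℕ) : pastWord p (t + 1) = p t :: pastWord p t := by
  simp [pastWord, List.range_succ]

theorem length_pastWord (p : ℕ → X) (t : ℕ) : (pastWord p t).length = t := by
  simp [pastWord]

theorem drop_pastWord (p : ℕ → X) (t d : ℕ) : (pastWord p (t + d)).drop d = pastWord p t := by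
  induction d with
  | zero => rfl
  | succ d ih => rw [← add_assoc, pastWord_succ, List.drop_succ_cons, ih]

theorem pastWord_extendPast (p : ℕ → X) (x : X) (t : ℕ) :
    pastWord (extendPast p x) (t + 1) = pastWord p t ++ [x] := by
  induction t with
  | zero => simp [pastWord, extendPast]
  | succ t ih => rw [pastWord_succ, ih, pastWord_succ p t]; rfl

theorem shift_iterate (t : ℕ) (ω : ℤ → X) (n : ℤ) : (shift^[t] ω) n = ω (n + t) := by
  induction t generalizing ω with
  | zero => simp
  | succ t ih =>
    rw [Function.iterate_succ_apply, ih, shift]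
    congr 1
    push_cast
    ring

theorem pastMap_shift (ω : ℤ → X) : pastMap (shift ω) = extendPast (pastMap ω) (ω 0) := by
  funext n
  cases n with
  | zero => simp [pastMap, shift, extendPast]
  | succ n => simp [pastMap, shift, extendPast]

theorem pastWord_pastMap_shift_iterate (t : ℕ) (ω : ℤ → X) :
    pastWord (pastMap (shift^[t] ω)) t = initialWord t ω := by
  refine List.ext_getElem (by simp [pastWord, initialWord]) fun i h1 h2 => ?_
  have hi : i < t := by simpa [initialWord] using h2
  simp only [pastWord, pastMap, shift_iterate, initialWord, List.getElem_map,
    List.getElem_reverse, List.getElem_range, List.length_range]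
  congr 1
  omega

theorem initialWord_add (m n : ℕ) (ω : ℤ → X) :
    initialWord (m + n) ω = initialWord m ω ++ initialWord n (shift^[m] ω) := by
  simp only [initialWord, List.range_add, List.map_append, List.map_map]
  congr 1
  refine List.map_congr_left fun k _ => ?_
  simp only [Function.comp, shift_iterate]
  congr 1
  push_cast
  ring

theorem shift_iterate_preimage_inter_wordCylinder (v w : List X) :
    shift^[v.length] ⁻¹' ({ω | pastWord (pastMap ω) v.length = v} ∩ wordCylinder w) =
      wordCylinder (v ++ w) := by
  ext ω
  simp only [wordCylinder, Set.mem_preimage, Set.mem_inter_iff, Set.mem_ofPred_eq,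
    pastWord_pastMap_shift_iterate, List.length_append, initialWord_add]
  constructor
  · rintro ⟨h1, h2⟩
    rw [h1, h2]
  · intro h
    exact List.append_inj h (by simp [initialWord])

theorem wordCylinder_nil : wordCylinder ([] : List X) = Set.univ := by
  ext ω
  simp [wordCylinder, initialWord]

theorem wordCylinder_append_subset (v w : List X) : wordCylinder (v ++ w) ⊆ wordCylinder v := by
  intro ω h
  simp only [wordCylinder, Set.mem_ofPred_eq, List.length_append, initialWord_add] at h ⊢
  exact (List.append_inj h (by simp [initialWord])).1

variable (X) in
/-- The sets of pasts determined by finitely many symbols. -/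
def pastCylinders : Set (Set (ℕ → X)) :=
  {s | ∃ (t : ℕ) (S : Set (List X)), s = {q | pastWord q t ∈ S}}

theorem exists_pastCylinder_of_le {t t' : ℕ} (h : t ≤ t') (S : Set (List X)) :
    ∃ S' : Set (List X), {q : ℕ → X | pastWord q t ∈ S} = {q | pastWord q t' ∈ S'} := by
  obtain ⟨d, rfl⟩ := Nat.exists_eq_add_of_le h
  exact ⟨{l | l.drop d ∈ S}, by simp only [Set.mem_ofPred_eq, drop_pastWord]⟩

theorem isPiSystem_pastCylinders : IsPiSystem (pastCylinders X) := by
  rintro _ ⟨t, S, rfl⟩ _ ⟨t', S', rfl⟩ -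
  obtain ⟨A, hA⟩ := exists_pastCylinder_of_le (le_max_left t t') S
  obtain ⟨B, hB⟩ := exists_pastCylinder_of_le (le_max_right t t') S'
  rw [hA, hB]
  exact ⟨max t t', A ∩ B, rfl⟩

end WordCylinders

section Measurability

variable {X : Type*} [MeasurableSpace X]

theorem measurable_shift : Measurable (shift : (ℤ → X) → ℤ → X) :=
  measurable_pi_lambda _ fun _ => measurable_pi_apply _

theorem measurable_pastMap : Measurable (pastMap : (ℤ → X) → ℕ → X) :=
  measurable_pi_lambda _ fun _ => measurable_pi_apply _

variable [Fintype X] [MeasurableSingletonClass X]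

local instance : MeasurableSpace (List X) := ⊤

local instance : DiscreteMeasurableSpace (List X) := ⟨fun _ => trivial⟩

theorem measurable_pastWord (t : ℕ) : Measurable fun q : ℕ → X => pastWord q t := by
  induction t with
  | zero => simp only [pastWord, List.range_zero, List.reverse_nil, List.map_nil, measurable_const]
  | succ t ih =>
    simp only [pastWord_succ]
    exact (Measurable.of_discrete (f := fun z : X × List X => z.1 :: z.2)).comp
      ((measurable_pi_apply t).prodMk ih)

theorem measurable_initialWord (n : ℕ) : Measurable (initialWord n : (ℤ → X) → List X) := by
  induction n with
  | zero => exact measurable_const (a := [])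
  | succ n ih =>
    have h : (initialWord (n + 1) : (ℤ → X) → List X) = fun ω => initialWord n ω ++ [ω n] := by
      funext ω
      simp [initialWord, List.range_succ]
    rw [h]
    exact (Measurable.of_discrete (f := fun z : X × List X => z.2 ++ [z.1])).comp
      ((measurable_pi_apply _).prodMk ih)

theorem measurableSet_wordCylinder (w : List X) : MeasurableSet (wordCylinder w) :=
  measurable_initialWord w.length (measurableSet_singleton w)

theorem measurable_condProb_pastWord (μ : Measure (ℤ → X)) (w : List X) (t : ℕ) :
    Measurable fun q : ℕ → X => condProb μ w (pastWord q t) :=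
  (Measurable.of_discrete (f := condProb μ w)).comp (measurable_pastWord t)

theorem generateFrom_pastCylinders :
    (inferInstance : MeasurableSpace (ℕ → X)) = MeasurableSpace.generateFrom (pastCylinders X) := by
  apply le_antisymm
  · refine iSup_le fun n => ?_
    rintro _ ⟨S, -, rfl⟩
    refine MeasurableSpace.measurableSet_generateFrom
      ⟨n + 1, {l | ∃ x ∈ S, l.head? = some x}, ?_⟩
    ext q
    simp [pastWord_succ]
  · refine MeasurableSpace.generateFrom_le ?_
    rintro _ ⟨t, S, rfl⟩
    exact measurable_pastWord t (MeasurableSet.of_discrete (s := S))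

end Measurability

section Stationary

variable {X : Type*} [MeasurableSpace X] {μ : Measure (ℤ → X)}

theorem wordProb_nonneg (w : List X) : 0 ≤ wordProb μ w := ENNReal.toReal_nonneg

theorem condProb_nonneg (w v : List X) : 0 ≤ condProb μ w v :=
  div_nonneg (wordProb_nonneg _) (wordProb_nonneg _)

/-- The joint law of the past and of the event that the word `w` comes next. -/
noncomputable def pastMeasureOn (μ : Measure (ℤ → X)) (w : List X) : Measure (ℕ → X) :=
  (μ.restrict (wordCylinder w)).map pastMap

theorem pastMeasureOn_apply (w : List X) {A : Set (ℕ → X)} (hA : MeasurableSet A) :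
    pastMeasureOn μ w A = μ (pastMap ⁻¹' A ∩ wordCylinder w) := by
  rw [pastMeasureOn, Measure.map_apply measurable_pastMap hA,
    Measure.restrict_apply (measurable_pastMap hA)]

theorem pastMeasureOn_nil : pastMeasureOn μ ([] : List X) = pastMeasure μ := by
  rw [pastMeasureOn, wordCylinder_nil, Measure.restrict_univ, pastMeasure]

variable [Fintype X] [IsProbabilityMeasure μ]

theorem wordProb_append_le (v w : List X) : wordProb μ (v ++ w) ≤ wordProb μ v := by
  rw [wordProb_eq_measureReal, wordProb_eq_measureReal]
  exact measureReal_mono (wordCylinder_append_subset v w)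

theorem condProb_le_one (w v : List X) : condProb μ w v ≤ 1 :=
  div_le_one_of_le₀ (wordProb_append_le _ _) (wordProb_nonneg _)

theorem condProb_mul_wordProb (w v : List X) :
    condProb μ w v * wordProb μ v = wordProb μ (v ++ w) := by
  rcases eq_or_ne (wordProb μ v) 0 with h | h
  · rw [h, mul_zero]
    exact le_antisymm (wordProb_nonneg _) (h ▸ wordProb_append_le v w)
  · exact div_mul_cancel₀ _ h

variable [MeasurableSingletonClass X]

theorem measure_pastWord_eq_inter_wordCylinder (hstat : Stationary μ) (v w : List X) :
    μ ({ω | pastWord (pastMap ω) v.length = v} ∩ wordCylinder w) =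
      ENNReal.ofReal (wordProb μ (v ++ w)) := by
  have hm : MeasurePreserving shift^[v.length] μ μ :=
    MeasurePreserving.iterate ⟨measurable_shift, hstat⟩ _
  have hs : MeasurableSet {ω : ℤ → X | pastWord (pastMap ω) v.length = v} :=
    let _ : MeasurableSpace (List X) := ⊤
    (measurable_pastWord v.length).comp measurable_pastMap (show MeasurableSet {v} from trivial)
  rw [wordProb_eq_measureReal, ofReal_measureReal,
    ← shift_iterate_preimage_inter_wordCylinder,
    hm.measure_preimage (hs.inter (measurableSet_wordCylinder w)).nullMeasurableSet]

theorem wordProb_append_le_right (hstat : Stationary μ) (v w : List X) :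
    wordProb μ (v ++ w) ≤ wordProb μ w := by
  rw [← ENNReal.ofReal_le_ofReal_iff (wordProb_nonneg w),
    ← measure_pastWord_eq_inter_wordCylinder hstat, wordProb_eq_measureReal, ofReal_measureReal]
  exact measure_mono Set.inter_subset_right

instance (w : List X) : IsFiniteMeasure (pastMeasureOn μ w) := by
  unfold pastMeasureOn; infer_instance

instance : IsProbabilityMeasure (pastMeasure μ) :=
  Measure.isProbabilityMeasure_map measurable_pastMap.aemeasurable

theorem pastMeasureOn_pastWord_eq (hstat : Stationary μ) (w v : List X) (t : ℕ) :
    pastMeasureOn μ w {q | pastWord q t = v} =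
      if v.length = t then ENNReal.ofReal (wordProb μ (v ++ w)) else 0 := by
  split_ifs with h
  · subst h
    let _ : MeasurableSpace (List X) := ⊤
    have hs : MeasurableSet {q : ℕ → X | pastWord q v.length = v} :=
      measurable_pastWord v.length (show MeasurableSet {v} from trivial)
    rw [pastMeasureOn_apply w hs, ← measure_pastWord_eq_inter_wordCylinder hstat]
    rfl
  · convert measure_empty (μ := pastMeasureOn μ w)
    refine Set.eq_empty_of_forall_notMem fun q hq => h ?_
    rw [← show pastWord q t = v from hq, length_pastWord]

theorem setLIntegral_condProb_pastWord (hstat : Stationary μ) (w : List X) (t : ℕ)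
    (S : Set (List X)) :
    ∫⁻ q in {q | pastWord q t ∈ S}, ENNReal.ofReal (condProb μ w (pastWord q t)) ∂(pastMeasure μ) =
      pastMeasureOn μ w {q | pastWord q t ∈ S} := by
  let _ : MeasurableSpace (List X) := ⊤
  have : DiscreteMeasurableSpace (List X) := ⟨fun _ => trivial⟩
  have hf : Measurable fun l : List X => ENNReal.ofReal (condProb μ w l) := .of_discrete
  have hp := measurable_pastWord (X := X) t
  have key : ((pastMeasure μ).map fun q => pastWord q t).withDensity
      (fun l => ENNReal.ofReal (condProb μ w l)) =
      (pastMeasureOn μ w).map fun q => pastWord q t := by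
    refine Measure.ext_of_singleton fun v => ?_
    rw [withDensity_apply _ (measurableSet_singleton v), lintegral_singleton,
      Measure.map_apply hp (measurableSet_singleton v),
      Measure.map_apply hp (measurableSet_singleton v), ← pastMeasureOn_nil]
    change _ * pastMeasureOn μ [] {q | pastWord q t = v} =
      pastMeasureOn μ w {q | pastWord q t = v}
    rw [pastMeasureOn_pastWord_eq hstat, pastMeasureOn_pastWord_eq hstat]
    split_ifs
    · rw [List.append_nil, ← ENNReal.ofReal_mul (condProb_nonneg _ _), condProb_mul_wordProb]
    · exact mul_zero _
  have h := congrArg (fun m => m S) key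
  rw [withDensity_apply _ (MeasurableSet.of_discrete (s := S)),
    setLIntegral_map (MeasurableSet.of_discrete (s := S)) hf hp,
    Measure.map_apply hp (MeasurableSet.of_discrete (s := S))] at h
  exact h

/-- If the conditional probabilities of `w` converge almost surely, then their limit is the density
of the joint law of the past and of `w` with respect to the law of the past. -/
theorem withDensity_eq_pastMeasureOn (hstat : Stationary μ) (w : List X) {f : (ℕ → X) → ℝ}
    (hf : ∀ᵐ q ∂(pastMeasure μ), Tendsto (fun t => condProb μ w (pastWord q t)) atTop (𝓝 (f q))) :
    (pastMeasure μ).withDensity (fun q => ENNReal.ofReal (f q)) = pastMeasureOn μ w := by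
  have hcyl : ∀ s ∈ pastCylinders X,
      pastMeasureOn μ w s = (pastMeasure μ).withDensity (fun q => ENNReal.ofReal (f q)) s := by
    rintro _ ⟨t, S, rfl⟩
    have hS : MeasurableSet {q : ℕ → X | pastWord q t ∈ S} :=
      let _ : MeasurableSpace (List X) := ⊤
      measurable_pastWord t (show MeasurableSet S from trivial)
    rw [withDensity_apply _ hS]
    have hlim := tendsto_lintegral_of_dominated_convergence
      (μ := (pastMeasure μ).restrict {q | pastWord q t ∈ S})
      (F := fun n q => ENNReal.ofReal (condProb μ w (pastWord q n)))
      (f := fun q => ENNReal.ofReal (f q)) (fun _ => 1)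
      (fun n => (measurable_condProb_pastWord μ w n).ennreal_ofReal)
      (fun n => ae_of_all _ fun q => ENNReal.ofReal_le_one.2 (condProb_le_one _ _))
      (by simp)
      ((ae_restrict_of_ae hf).mono fun q hq => ENNReal.tendsto_ofReal hq)
    refine tendsto_nhds_unique (tendsto_const_nhds.congr' ?_) hlim
    filter_upwards [eventually_ge_atTop t] with n hn
    obtain ⟨S', hS'⟩ := exists_pastCylinder_of_le hn S
    rw [hS', setLIntegral_condProb_pastWord hstat]
  refine (ext_of_generate_finite _ generateFrom_pastCylinders isPiSystem_pastCylinders hcyl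
    (hcyl _ ⟨0, Set.univ, by simp⟩)).symm

end Stationary

section PredictiveClasses

variable {X : Type*} [MeasurableSpace X] {μ : Measure (ℤ → X)}

theorem Regular.tendsto_condProb {p : ℕ → X} (hp : Regular μ p) {w : List X} (hw : w ≠ []) :
    Tendsto (fun t => condProb μ w (pastWord p t)) atTop (𝓝 (predProb μ p w)) :=
  tendsto_nhds_limUnder (hp.2 w hw)

theorem Regular.mem_classOf {p : ℕ → X} (hp : Regular μ p) : p ∈ classOf μ p :=
  ⟨hp, fun _ _ => rfl⟩

theorem classOf_eq_of_mem {p q : ℕ → X} (h : q ∈ classOf μ p) : classOf μ q = classOf μ p := by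
  ext r
  exact and_congr_right fun _ => forall₂_congr fun w hw => by rw [h.2 w hw]

theorem mem_classOf_iff_tendsto {p q : ℕ → X} :
    q ∈ classOf μ p ↔ Nontrivial' μ q ∧ ∀ w : List X, w ≠ [] →
      Tendsto (fun t => condProb μ w (pastWord q t)) atTop (𝓝 (predProb μ p w)) := by
  constructor
  · rintro ⟨hq, h⟩
    exact ⟨hq.1, fun w hw => h w hw ▸ hq.tendsto_condProb hw⟩
  · rintro ⟨hq, h⟩
    exact ⟨⟨hq, fun w hw => ⟨_, h w hw⟩⟩, fun w hw => (h w hw).limUnder_eq⟩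

theorem predProb_nonneg {p : ℕ → X} (hp : Regular μ p) {w : List X} (hw : w ≠ []) :
    0 ≤ predProb μ p w :=
  ge_of_tendsto' (hp.tendsto_condProb hw) fun _ => condProb_nonneg _ _

theorem measurableSet_classOf [Fintype X] [MeasurableSingletonClass X] (p : ℕ → X) :
    MeasurableSet (classOf μ p) := by
  have h : classOf μ p = (⋂ t, {q | 0 < wordProb μ (pastWord q t)}) ∩
      ⋂ (w : List X) (_ : w ≠ []),
        {q | Tendsto (fun t => condProb μ w (pastWord q t)) atTop (𝓝 (predProb μ p w))} := by
    ext q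
    simp only [mem_classOf_iff_tendsto, Nontrivial', Set.mem_inter_iff, Set.mem_iInter,
      Set.mem_ofPred_eq]
  rw [h]
  refine (MeasurableSet.iInter fun t => ?_).inter
    (MeasurableSet.iInter fun w => MeasurableSet.iInter fun _ => ?_)
  · let _ : MeasurableSpace (List X) := ⊤
    exact measurable_pastWord t (show MeasurableSet {l | 0 < wordProb μ l} from trivial)
  · exact measurableSet_tendsto _ fun t => measurable_condProb_pastWord μ w t

variable [Fintype X] [IsProbabilityMeasure μ]

theorem condProb_cons (x : X) (u v : List X) :
    condProb μ (x :: u) v = condProb μ [x] v * condProb μ u (v ++ [x]) := by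
  have h : v ++ x :: u = (v ++ [x]) ++ u := by simp
  rw [condProb, h, ← condProb_mul_wordProb u (v ++ [x]), mul_div_assoc, mul_comm]
  rfl

theorem predProb_cons_eq_zero {p : ℕ → X} (hp : Regular μ p) {x : X}
    (hx : predProb μ p [x] = 0) (u : List X) : predProb μ p (x :: u) = 0 := by
  refine le_antisymm (hx ▸ ?_) (predProb_nonneg hp (List.cons_ne_nil _ _))
  refine le_of_tendsto_of_tendsto' (hp.tendsto_condProb (List.cons_ne_nil _ _))
    (hp.tendsto_condProb (List.cons_ne_nil _ _)) fun t => ?_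
  rw [condProb_cons]
  exact mul_le_of_le_one_right (condProb_nonneg _ _) (condProb_le_one _ _)

theorem tendsto_condProb_extendPast {p : ℕ → X} (hp : Regular μ p) {x : X}
    (hx : 0 < predProb μ p [x]) (u : List X) :
    Tendsto (fun t => condProb μ u (pastWord (extendPast p x) t)) atTop
      (𝓝 (predProb μ p (x :: u) / predProb μ p [x])) := by
  rw [← tendsto_add_atTop_iff_nat 1]
  have h1 := hp.tendsto_condProb (List.cons_ne_nil x [])
  refine ((hp.tendsto_condProb (List.cons_ne_nil x u)).div h1 hx.ne').congr' ?_
  filter_upwards [h1.eventually (lt_mem_nhds hx)] with t ht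
  rw [Pi.div_apply, pastWord_extendPast, condProb_cons, mul_div_cancel_left₀ _ ht.ne']

theorem predProb_extendPast {p : ℕ → X} (hp : Regular μ p) {x : X}
    (hx : 0 < predProb μ p [x]) (u : List X) :
    predProb μ (extendPast p x) u = predProb μ p (x :: u) / predProb μ p [x] :=
  (tendsto_condProb_extendPast hp hx u).limUnder_eq

variable [MeasurableSingletonClass X]

theorem antitone_wordProb_pastWord (hstat : Stationary μ) (q : ℕ → X) :
    Antitone fun t => wordProb μ (pastWord q t) :=
  antitone_nat_of_succ_le fun t => by
    rw [pastWord_succ]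
    exact wordProb_append_le_right hstat [q t] (pastWord q t)

theorem nontrivial_extendPast (hstat : Stationary μ) {p : ℕ → X} (hp : Regular μ p) {x : X}
    (hx : 0 < predProb μ p [x]) : Nontrivial' μ (extendPast p x) := by
  intro t
  obtain ⟨s, hs, hts⟩ := (((hp.tendsto_condProb (List.cons_ne_nil x [])).eventually
    (lt_mem_nhds hx)).and (eventually_ge_atTop t)).exists
  refine lt_of_lt_of_le ?_ (antitone_wordProb_pastWord hstat _ (hts.trans s.le_succ))
  simp only [Nat.succ_eq_add_one]
  rw [pastWord_extendPast, ← condProb_mul_wordProb]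
  exact mul_pos hs (hp.1 s)

theorem regular_extendPast (hstat : Stationary μ) {p : ℕ → X} (hp : Regular μ p) {x : X}
    (hx : 0 < predProb μ p [x]) : Regular μ (extendPast p x) :=
  ⟨nontrivial_extendPast hstat hp hx, fun u _ => ⟨_, tendsto_condProb_extendPast hp hx u⟩⟩

theorem extendPast_mem_classOf (hstat : Stationary μ) {p q : ℕ → X} (hp : Regular μ p)
    (hq : q ∈ classOf μ p) {x : X} (hx : 0 < predProb μ p [x]) :
    extendPast q x ∈ classOf μ (extendPast p x) := by
  have hq1 := hq.2 [x] (List.cons_ne_nil _ _)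
  have hqx : 0 < predProb μ q [x] := hq1 ▸ hx
  refine ⟨regular_extendPast hstat hq.1 hqx, fun u _ => ?_⟩
  rw [predProb_extendPast hq.1 hqx, predProb_extendPast hp hx, hq1,
    hq.2 (x :: u) (List.cons_ne_nil _ _)]

end PredictiveClasses

section FinitelyCharacterized

variable {X : Type*} [MeasurableSpace X] {N : ℕ} {μ : Measure (ℤ → X)} {p : Fin N → (ℕ → X)}

theorem FinitelyCharacterized.pairwise_disjoint (hfc : FinitelyCharacterized μ p) :
    Pairwise (Function.onFun Disjoint fun i => classOf μ (p i)) := fun i j hij =>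
  Set.disjoint_left.2 fun _ hi hj =>
    hfc.2.1 i j hij ((classOf_eq_of_mem hi).symm.trans (classOf_eq_of_mem hj))

variable [Fintype X] [MeasurableSingletonClass X] [IsProbabilityMeasure μ]

theorem FinitelyCharacterized.ae_mem_iUnion (hfc : FinitelyCharacterized μ p) :
    ∀ᵐ q ∂(pastMeasure μ), q ∈ ⋃ i, classOf μ (p i) := by
  have hm : MeasurableSet (⋃ i, classOf μ (p i)) :=
    MeasurableSet.iUnion fun i => measurableSet_classOf _
  change (⋃ i, classOf μ (p i)) ∈ ae (pastMeasure μ)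
  rw [mem_ae_iff_prob_eq_one hm,
    measure_iUnion hfc.pairwise_disjoint fun i => measurableSet_classOf _, tsum_fintype]
  exact hfc.2.2.2

theorem FinitelyCharacterized.withDensity_predProb (hstat : Stationary μ)
    (hfc : FinitelyCharacterized μ p) {w : List X} (hw : w ≠ []) :
    (pastMeasure μ).withDensity (fun q => ENNReal.ofReal (predProb μ q w)) =
      pastMeasureOn μ w :=
  withDensity_eq_pastMeasureOn hstat w <| hfc.ae_mem_iUnion.mono fun q hq => by
    obtain ⟨i, hi⟩ := Set.mem_iUnion.1 hq
    exact hi.1.tendsto_condProb hw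

theorem FinitelyCharacterized.pastMeasureOn_classOf (hstat : Stationary μ)
    (hfc : FinitelyCharacterized μ p) {w : List X} (hw : w ≠ []) (i : Fin N) :
    pastMeasureOn μ w (classOf μ (p i)) =
      ENNReal.ofReal (predProb μ (p i) w) * pastMeasure μ (classOf μ (p i)) := by
  rw [← hfc.withDensity_predProb hstat hw, withDensity_apply _ (measurableSet_classOf _),
    setLIntegral_congr_fun (g := fun _ => ENNReal.ofReal (predProb μ (p i) w))
      (measurableSet_classOf _) fun q hq => by simp only [hq.2 w hw],
    setLIntegral_const]

/-- The process probability of a word is the average of its predicted probabilities. -/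
theorem FinitelyCharacterized.wordProb_eq_sum (hstat : Stationary μ)
    (hfc : FinitelyCharacterized μ p) {w : List X} (hw : w ≠ []) :
    wordProb μ w = ∑ i, (pastMeasure μ (classOf μ (p i))).toReal * predProb μ (p i) w := by
  have hac : pastMeasureOn μ w ≪ pastMeasure μ :=
    hfc.withDensity_predProb hstat hw ▸ withDensity_absolutelyContinuous _ _
  have huniv : pastMeasureOn μ w (⋃ i, classOf μ (p i)) = pastMeasureOn μ w Set.univ :=
    measure_congr (eventuallyEq_univ.2 (hac.ae_le hfc.ae_mem_iUnion))
  rw [pastMeasureOn_apply w MeasurableSet.univ, Set.preimage_univ, Set.univ_inter,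
    measure_iUnion hfc.pairwise_disjoint fun i => measurableSet_classOf _, tsum_fintype] at huniv
  rw [wordProb_eq_measureReal, Measure.real, ← huniv,
    ENNReal.toReal_sum fun i _ => measure_ne_top _ _]
  refine Finset.sum_congr rfl fun i _ => ?_
  rw [hfc.pastMeasureOn_classOf hstat hw, ENNReal.toReal_mul,
    ENNReal.toReal_ofReal (predProb_nonneg (hfc.1 i) hw), mul_comm]

/-- The class reached from a positive-probability class by a symbol of positive predicted
probability has positive probability. -/
theorem FinitelyCharacterized.exists_classOf_extendPast_eq (hstat : Stationary μ)
    (hfc : FinitelyCharacterized μ p) (i : Fin N) {x : X} (hx : 0 < predProb μ (p i) [x]) :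
    ∃ k, classOf μ (extendPast (p i) x) = classOf μ (p k) := by
  have hpos : 0 < pastMeasureOn μ [x] (classOf μ (p i)) := by
    rw [hfc.pastMeasureOn_classOf hstat (List.cons_ne_nil _ _)]
    exact ENNReal.mul_pos (ENNReal.ofReal_pos.2 hx).ne' (hfc.2.2.1 i).ne'
  rw [pastMeasureOn_apply _ (measurableSet_classOf _)] at hpos
  have hsub : pastMap ⁻¹' classOf μ (p i) ∩ wordCylinder [x] ⊆
      shift ⁻¹' (pastMap ⁻¹' classOf μ (extendPast (p i) x)) := by
    rintro ω ⟨h1, h2⟩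
    have h0 : ω 0 = x := by simpa [wordCylinder, initialWord] using h2
    rw [Set.mem_preimage, Set.mem_preimage, pastMap_shift, h0]
    exact extendPast_mem_classOf hstat (hfc.1 i) h1 hx
  have hpos' := hpos.trans_le (measure_mono hsub)
  rw [(⟨measurable_shift, hstat⟩ : MeasurePreserving shift μ μ).measure_preimage
      (measurable_pastMap (measurableSet_classOf _)).nullMeasurableSet,
    ← Measure.map_apply measurable_pastMap (measurableSet_classOf _)] at hpos'
  obtain ⟨q, hq, hq'⟩ := (frequently_ae_mem_iff.2 hpos'.ne').and_eventually
    hfc.ae_mem_iUnion |>.exists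
  obtain ⟨k, hk⟩ := Set.mem_iUnion.1 hq'
  exact ⟨k, (classOf_eq_of_mem hq).symm.trans (classOf_eq_of_mem hk)⟩

/-- The word probabilities of the states of the history machine are the predicted
probabilities. -/
theorem FinitelyCharacterized.stateWordProb_histT (hstat : Stationary μ)
    (hfc : FinitelyCharacterized μ p) {w : List X} (hw : w ≠ []) (i : Fin N) :
    stateWordProb (histT μ p) i w = predProb μ (p i) w := by
  induction w generalizing i with
  | nil => exact absurd rfl hw
  | cons x u ih =>
    have hsum : stateWordProb (histT μ p) i (x :: u) =
        ∑ k, histT μ p x i k * stateWordProb (histT μ p) k u := by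
      simp only [stateWordProb, wordMatrix, List.map_cons, List.prod_cons, Matrix.mul_apply,
        Finset.mul_sum]
      exact Finset.sum_comm
    rw [hsum]
    rcases (predProb_nonneg (hfc.1 i) (List.cons_ne_nil x [])).eq_or_lt with hx | hx
    · rw [predProb_cons_eq_zero (hfc.1 i) hx.symm]
      exact Finset.sum_eq_zero fun k _ => by simp [histT, ← hx]
    · obtain ⟨k, hk⟩ := hfc.exists_classOf_extendPast_eq hstat i hx
      rw [Finset.sum_eq_single k
        (fun j _ hj => by
          rw [histT, if_neg fun h => hfc.2.1 j k hj (h.2.symm.trans hk), zero_mul])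
        (fun h => absurd (Finset.mem_univ k) h), histT, if_pos ⟨hx, hk⟩]
      rcases eq_or_ne u [] with rfl | hu
      · simp [stateWordProb, wordMatrix, Matrix.one_apply]
      · have hmem : extendPast (p i) x ∈ classOf μ (p k) :=
          hk ▸ (regular_extendPast hstat (hfc.1 i) hx).mem_classOf
        rw [ih hu, ← hmem.2 u hu, predProb_extendPast (hfc.1 i) hx, mul_div_cancel₀ _ hx.ne']

end FinitelyCharacterized

/-- For every word w, ℙ(w) = ‖μ T^(w)‖₁, where
μ = (ℙ⁻(E_1),…,ℙ⁻(E_N)) and {T^(x)} are the history ε-machine matrices. -/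
theorem history_word_probs
    {X : Type*} [Fintype X] [MeasurableSpace X] [MeasurableSingletonClass X]
    {N : ℕ} (μ : Measure (ℤ → X)) [IsProbabilityMeasure μ]
    (hstat : Stationary μ) (herg : Ergodic' μ)
    (p : Fin N → (ℕ → X)) (hfc : FinitelyCharacterized μ p) :
    ∀ w : List X, w ≠ [] →
      wordProb μ w =
        ∑ j, ∑ i, (pastMeasure μ (classOf μ (p i))).toReal * wordMatrix (histT μ p) w i j := by
  intro w hw
  rw [hfc.wordProb_eq_sum hstat hw, Finset.sum_comm]
  refine Finset.sum_congr rfl fun i _ => ?_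
  rw [← Finset.mul_sum, ← hfc.stateWordProb_histT hstat hw i, stateWordProb]

end EM
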